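/- Consider the parametric variational inequality v ∈ f(x,p) + N_C(x) in a real Hilbert space X with C ⊂ X nonempty closed convex, reference solution x̄ ∈ Ŝ(v̄,p̄), v̂ := v̄ − f(x̄,p̄), and f satisfying the standing assumptions. Then: (A) if Q(w) := ⟨∇_x f(x̄,p̄)w, w⟩ is a Legendre form and ⟨∇_x f(x̄,p̄)w, w⟩ > 0 for all nonzero w ∈ ℋ^w(x̄,v̂), then x̄ is a fully stable solution corresponding to (v̄,p̄); (B) if C is polyhedric and x̄ is a fully stable solution corresponding to (v̄,p̄), then ⟨∇_x f(x̄,p̄)w, w⟩ > 0 for all nonzero w ∈ ℋ^s(x̄,v̂). -/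

import Mathlib

noncomputable section

open Filter Topology Metric Set MeasureTheory
open scoped RealInnerProductSpace Pointwise

namespace PVS

variable {X : Type*} [NormedAddCommGroup X] [InnerProductSpace ℝ X]
variable {Y : Type*} [NormedAddCommGroup Y] [InnerProductSpace ℝ Y]
variable {W : Type*} [NormedAddCommGroup W] [InnerProductSpace ℝ W]
variable {P : Type*} [MetricSpace P]
variable {Q : Type*} [MetricSpace Q]

/-- Regular (Fréchet) subdifferential of an extended-real-valued function. -/
def regSubdiff (h : X → EReal) (x : X) : Set X :=
  {v | h x ≠ ⊤ ∧ h x ≠ ⊥ ∧ ∀ ε > (0:ℝ), ∀ᶠ u in 𝓝 x,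
      h x + ((⟪v, u - x⟫ - ε * ‖u - x‖ : ℝ) : EReal) ≤ h u}

/-- Weak sequential convergence in an inner product space. -/
def WeakTendsto (xs : ℕ → X) (x : X) : Prop :=
  ∀ z : X, Tendsto (fun k => ⟪xs k, z⟫) atTop (𝓝 ⟪x, z⟫)

/-- Limiting (Mordukhovich) subdifferential. -/
def limSubdiff (h : X → EReal) (x : X) : Set X :=
  {v | ∃ xs vs : ℕ → X, Tendsto xs atTop (𝓝 x) ∧
      Tendsto (fun k => h (xs k)) atTop (𝓝 (h x)) ∧
      (∀ k, vs k ∈ regSubdiff h (xs k)) ∧ WeakTendsto vs v}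

/-- Partial limiting subdifferential with respect to the first variable. -/
def pSubdiff {PP : Type*} (g : X → PP → EReal) (x : X) (p : PP) : Set X :=
  limSubdiff (fun x' => g x' p) x

/-- Graph of a set-valued map. -/
def gph (F : X → Set Y) : Set (X × Y) := {t | t.2 ∈ F t.1}

/-- Regular normal cone. -/
def regNC (Ω : Set X) (x : X) : Set X :=
  {v | ∀ ε > (0:ℝ), ∀ᶠ y in 𝓝[Ω] x, ⟪v, y - x⟫ ≤ ε * ‖y - x‖}

/-- Limiting normal cone. -/
def limNC (Ω : Set X) (x : X) : Set X :=
  {v | ∃ xs vs : ℕ → X, (∀ k, xs k ∈ Ω) ∧ Tendsto xs atTop (𝓝 x) ∧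
      (∀ k, vs k ∈ regNC Ω (xs k)) ∧ Tendsto vs atTop (𝓝 v)}

/-- Regular normal cone to a subset of a product of two inner product spaces,
with the Euclidean product norm. -/
def regNC2 (Ω : Set (X × Y)) (ω : X × Y) : Set (X × Y) :=
  {ζ | ∀ ε > (0:ℝ), ∀ᶠ y in 𝓝[Ω] ω,
      ⟪ζ.1, y.1 - ω.1⟫ + ⟪ζ.2, y.2 - ω.2⟫
        ≤ ε * Real.sqrt (‖y.1 - ω.1‖ ^ 2 + ‖y.2 - ω.2‖ ^ 2)}

/-- Limiting normal cone in a product of two spaces. -/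
def limNC2 (Ω : Set (X × Y)) (ω : X × Y) : Set (X × Y) :=
  {ζ | ∃ ωs ζs : ℕ → X × Y, (∀ k, ωs k ∈ Ω) ∧ Tendsto ωs atTop (𝓝 ω) ∧
      (∀ k, ζs k ∈ regNC2 Ω (ωs k)) ∧ Tendsto ζs atTop (𝓝 ζ)}

/-- Regular coderivative of a set-valued map. -/
def regCoderiv (F : X → Set Y) (u : X) (v : Y) (w : Y) : Set X :=
  {z | (z, -w) ∈ regNC2 (gph F) (u, v)}

/-- Limiting coderivative of a set-valued map. -/
def limCoderiv (F : X → Set Y) (u : X) (v : Y) (w : Y) : Set X :=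
  {z | (z, -w) ∈ limNC2 (gph F) (u, v)}

/-- Regular normal cone in a product of three inner product spaces. -/
def regNC3 (Ω : Set (X × W × Y)) (ω : X × W × Y) : Set (X × W × Y) :=
  {ζ | ∀ ε > (0:ℝ), ∀ᶠ y in 𝓝[Ω] ω,
      ⟪ζ.1, y.1 - ω.1⟫ + ⟪ζ.2.1, y.2.1 - ω.2.1⟫ + ⟪ζ.2.2, y.2.2 - ω.2.2⟫
        ≤ ε * Real.sqrt (‖y.1 - ω.1‖ ^ 2 + ‖y.2.1 - ω.2.1‖ ^ 2 + ‖y.2.2 - ω.2.2‖ ^ 2)}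

/-- Limiting normal cone in a product of three inner product spaces. -/
def limNC3 (Ω : Set (X × W × Y)) (ω : X × W × Y) : Set (X × W × Y) :=
  {ζ | ∃ ωs ζs : ℕ → X × W × Y, (∀ k, ωs k ∈ Ω) ∧ Tendsto ωs atTop (𝓝 ω) ∧
      (∀ k, ζs k ∈ regNC3 Ω (ωs k)) ∧ Tendsto ζs atTop (𝓝 ζ)}

/-- Limiting coderivative of the full partial subdifferential map (x,p) ↦ ∂ₓ g(x,p). -/
def limCoderivFull (g : X → W → EReal) (xb : X) (pb : W) (vh : X) (w : X) : Set (X × W) :=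
  {zs | (zs.1, zs.2, -w) ∈ limNC3 {t : X × W × X | t.2.2 ∈ pSubdiff g t.1 t.2.1} (xb, pb, vh)}

/-- Lipschitz-like (Aubin) property of a set-valued map around a graph point. -/
def LipschitzLike {α Z : Type*} [MetricSpace α] [SeminormedAddCommGroup Z]
    (F : α → Set Z) (ab : α) (zb : Z) : Prop :=
  ∃ ℓ > (0:ℝ), ∃ U ∈ 𝓝 ab, ∃ V ∈ 𝓝 zb,
    ∀ a ∈ U, ∀ a' ∈ U, ∀ z ∈ F a ∩ V, ∃ z' ∈ F a', ‖z - z'‖ ≤ ℓ * dist a a'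

/-- Epigraph of g(·,p). -/
def epi {PP : Type*} (g : X → PP → EReal) (p : PP) : Set (X × ℝ) :=
  {q | g q.1 p ≤ (q.2 : EReal)}

/-- (A1): Lipschitz continuity of the base around the reference point. -/
def A1 (f : X → P → Q → X) (xb : X) (pb : P) (qb : Q) : Prop :=
  ∃ L > (0:ℝ), ∃ ε > (0:ℝ), ∀ x₁ x₂ p₁ p₂ q₁ q₂,
    ‖x₁ - xb‖ < ε → ‖x₂ - xb‖ < ε → dist p₁ pb < ε → dist p₂ pb < ε →
    dist q₁ qb < ε → dist q₂ qb < ε →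
    ‖f x₁ p₁ q₁ - f x₂ p₂ q₂‖ ≤ L * (‖x₁ - x₂‖ + dist p₁ p₂ + dist q₁ q₂)

/-- Parametric prox-regularity with prox-parameter r. -/
def ProxRegWith (g : X → P → EReal) (xb : X) (pb : P) (vh : X) (r : ℝ) : Prop :=
  ∃ ε > (0:ℝ), ∀ x u p v, ‖x - xb‖ < ε → ‖u - xb‖ < ε → dist p pb < ε → ‖v - vh‖ < ε →
    v ∈ pSubdiff g u p →
    g u p + ((⟪v, x - u⟫ - r / 2 * ‖x - u‖ ^ 2 : ℝ) : EReal) ≤ g x p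

/-- Subdifferential continuity with compatible parameterization. -/
def SubdiffCont (g : X → P → EReal) (xb : X) (pb : P) (vh : X) : Prop :=
  Tendsto (fun t : X × P × X => g t.1 t.2.1)
    (𝓝[{t : X × P × X | t.2.2 ∈ pSubdiff g t.1 t.2.1}] (xb, pb, vh)) (𝓝 (g xb pb))

/-- (A2): parametric continuous prox-regularity. -/
def A2 (g : X → P → EReal) (xb : X) (pb : P) (vh : X) : Prop :=
  (∃ r > (0:ℝ), ProxRegWith g xb pb vh r) ∧ SubdiffCont g xb pb vh

/-- Threshold of prox-regularity. -/
def proxThreshold (g : X → P → EReal) (xb : X) (pb : P) (vh : X) : ℝ :=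
  sInf {r : ℝ | 0 < r ∧ ProxRegWith g xb pb vh r}

/-- (A3): basic constraint qualification. -/
def A3 (g : X → P → EReal) (xb : X) (pb : P) : Prop :=
  LipschitzLike (fun p => epi g p) pb (xb, (g xb pb).toReal)

/-- (A4): uniform partial differentiability with partial Jacobian continuous at the point. -/
def A4 (f : X → P → Q → X) (Df : X → P → Q → X →L[ℝ] X) (xb : X) (pb : P) (qb : Q) : Prop :=
  (∃ η > (0:ℝ), ∀ ε > (0:ℝ), ∃ δ > (0:ℝ), ∀ x p q,
      ‖x - xb‖ < η → dist p pb < η → dist q qb < η →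
      ∀ x', ‖x' - x‖ < δ →
        ‖f x' p q - f x p q - Df x p q (x' - x)‖ ≤ ε * ‖x' - x‖) ∧
  Tendsto (fun t : X × P × Q => Df t.1 t.2.1 t.2.2) (𝓝 (xb, pb, qb)) (𝓝 (Df xb pb qb))

/-- Solution map of the parametric variational system. -/
def SolMap (f : X → P → Q → X) (g : X → P → EReal) (v : X) (p : P) (q : Q) : Set X :=
  {x | v - f x p q ∈ pSubdiff g x p}

/-- Single-valued localization of a three-parametric solution map. -/
def Localizes3 (S : X → P → Q → Set X) (V : Set X) (Pn : Set P) (Qn : Set Q) (U : Set X)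
    (ϑ : X → P → Q → X) : Prop :=
  ∀ v ∈ V, ∀ p ∈ Pn, ∀ q ∈ Qn,
    ϑ v p q ∈ U ∧ ϑ v p q ∈ S v p q ∧ ∀ x ∈ U, x ∈ S v p q → x = ϑ v p q

/-- Lipschitzian full stability. -/
def LipFullStable (S : X → P → Q → Set X) (xb vb : X) (pb : P) (qb : Q) : Prop :=
  ∃ V ∈ 𝓝 vb, ∃ Pn ∈ 𝓝 pb, ∃ Qn ∈ 𝓝 qb, ∃ U ∈ 𝓝 xb, ∃ ϑ : X → P → Q → X,
    Localizes3 S V Pn Qn U ϑ ∧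
    ∃ κ > (0:ℝ), ∃ ℓ > (0:ℝ), ∀ v₁ ∈ V, ∀ p₁ ∈ Pn, ∀ q₁ ∈ Qn, ∀ v₂ ∈ V, ∀ p₂ ∈ Pn, ∀ q₂ ∈ Qn,
      ‖(v₁ - v₂) - (2 * κ) • (ϑ v₁ p₁ q₁ - ϑ v₂ p₂ q₂)‖
        ≤ ‖v₁ - v₂‖ + ℓ * (dist p₁ p₂ + dist q₁ q₂)

/-- Hölderian full stability with given moduli. -/
def HolderFullStableWith (S : X → P → Q → Set X) (xb vb : X) (pb : P) (qb : Q) (κ ℓ : ℝ) : Prop :=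
  ∃ V ∈ 𝓝 vb, ∃ Pn ∈ 𝓝 pb, ∃ Qn ∈ 𝓝 qb, ∃ U ∈ 𝓝 xb, ∃ ϑ : X → P → Q → X,
    Localizes3 S V Pn Qn U ϑ ∧
    ∀ v₁ ∈ V, ∀ p₁ ∈ Pn, ∀ q₁ ∈ Qn, ∀ v₂ ∈ V, ∀ p₂ ∈ Pn, ∀ q₂ ∈ Qn,
      ‖(v₁ - v₂) - (2 * κ) • (ϑ v₁ p₁ q₁ - ϑ v₂ p₂ q₂)‖
        ≤ ‖v₁ - v₂‖ + ℓ * (Real.sqrt (dist p₁ p₂) + dist q₁ q₂)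

/-- Hölderian full stability. -/
def HolderFullStable (S : X → P → Q → Set X) (xb vb : X) (pb : P) (qb : Q) : Prop :=
  ∃ κ > (0:ℝ), ∃ ℓ > (0:ℝ), HolderFullStableWith S xb vb pb qb κ ℓ

/-- Neighborhood second-order condition via the regular coderivative of ∂g_p. -/
def SOC (g : X → P → EReal) (A : X →L[ℝ] X) (xb : X) (pb : P) (vh : X) (η κ₀ : ℝ) : Prop :=
  ∀ u p v, ‖u - xb‖ ≤ η → dist p pb ≤ η → ‖v - vh‖ ≤ η → v ∈ pSubdiff g u p →
    ∀ w z, z ∈ regCoderiv (fun y => pSubdiff g y p) u v w →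
      κ₀ * ‖w‖ ^ 2 ≤ ⟪A w, w⟫ + ⟪z, w⟫

/-- The graphical map p ↦ gph ∂ₓ g(·,p). -/
def gphMap (g : X → P → EReal) (p : P) : Set (X × X) := {t | t.2 ∈ pSubdiff g t.1 p}

/-- Local strong monotonicity of f in x with modulus σ. -/
def StrongMono (f : X → P → Q → X) (xb : X) (pb : P) (qb : Q) (σ : ℝ) : Prop :=
  ∃ ε > (0:ℝ), ∀ x₁ x₂ p q, ‖x₁ - xb‖ < ε → ‖x₂ - xb‖ < ε → dist p pb < ε → dist q qb < ε →
    σ * ‖x₁ - x₂‖ ^ 2 ≤ ⟪f x₁ p q - f x₂ p q, x₁ - x₂⟫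

/-- The proximal mapping P_λ(v,p) = {x : v ∈ x + λ ∂ₓ g(x,p)}. -/
def proxMap (g : X → P → EReal) (lam : ℝ) (v : X) (p : P) : Set X :=
  {x | ∃ s ∈ pSubdiff g x p, v = x + lam • s}

/-- Single-valued localization of a two-parametric solution map. -/
def Localizes2 (S : X → P → Set X) (V : Set X) (Pn : Set P) (U : Set X) (ϑ : X → P → X) : Prop :=
  ∀ v ∈ V, ∀ p ∈ Pn, ϑ v p ∈ U ∧ ϑ v p ∈ S v p ∧ ∀ x ∈ U, x ∈ S v p → x = ϑ v p

/-- (Lipschitzian) full stability of a two-parametric system. -/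
def FullStable2 (S : X → P → Set X) (xb vb : X) (pb : P) : Prop :=
  ∃ V ∈ 𝓝 vb, ∃ Pn ∈ 𝓝 pb, ∃ U ∈ 𝓝 xb, ∃ ϑ : X → P → X,
    Localizes2 S V Pn U ϑ ∧
    ∃ κ > (0:ℝ), ∃ ℓ > (0:ℝ), ∀ v₁ ∈ V, ∀ p₁ ∈ Pn, ∀ v₂ ∈ V, ∀ p₂ ∈ Pn,
      ‖(v₁ - v₂) - (2 * κ) • (ϑ v₁ p₁ - ϑ v₂ p₂)‖ ≤ ‖v₁ - v₂‖ + ℓ * dist p₁ p₂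

/-- Normal cone of convex analysis. -/
def convNC (C : Set X) (x : X) : Set X := {v | x ∈ C ∧ ∀ y ∈ C, ⟪v, y - x⟫ ≤ 0}

/-- Solution map of a parametric variational inequality. -/
def SolMapVI (f : X → P → X) (C : Set X) (v : X) (p : P) : Set X :=
  {x | v - f x p ∈ convNC C x}

/-- Radial cone. -/
def radialCone (C : Set X) (x : X) : Set X := {w | ∃ t > (0:ℝ), x + t • w ∈ C}

/-- Tangent cone (closure of the radial cone). -/
def tangentC (C : Set X) (x : X) : Set X := closure (radialCone C x)

/-- Critical cone. -/
def criticalCone (C : Set X) (x v : X) : Set X := tangentC C x ∩ {w | ⟪v, w⟫ = 0}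

/-- Polyhedricity of a closed convex set. -/
def Polyhedric (C : Set X) : Prop :=
  ∀ x ∈ C, ∀ v ∈ convNC C x,
    criticalCone C x v = closure (radialCone C x ∩ {w | ⟪v, w⟫ = 0})

/-- Weak sequential outer limit of critical cones. -/
def Hw (C : Set X) (xb vh : X) : Set X :=
  {w | ∃ xs vs ws : ℕ → X, (∀ k, vs k ∈ convNC C (xs k)) ∧
      Tendsto xs atTop (𝓝 xb) ∧ Tendsto vs atTop (𝓝 vh) ∧
      (∀ k, ws k ∈ criticalCone C (xs k) (vs k)) ∧ WeakTendsto ws w}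

/-- Strong sequential outer limit of critical cones. -/
def Hs (C : Set X) (xb vh : X) : Set X :=
  {w | ∃ xs vs ws : ℕ → X, (∀ k, vs k ∈ convNC C (xs k)) ∧
      Tendsto xs atTop (𝓝 xb) ∧ Tendsto vs atTop (𝓝 vh) ∧
      (∀ k, ws k ∈ criticalCone C (xs k) (vs k)) ∧ Tendsto ws atTop (𝓝 w)}

/-- Convex polyhedron: finite intersection of closed half-spaces. -/
def IsPolyhedron (C : Set X) : Prop :=
  ∃ (k : ℕ) (a : Fin k → X) (b : Fin k → ℝ), C = {x | ∀ i, ⟪a i, x⟫ ≤ b i}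

/-- Legendre form. -/
def LegendreForm (Qf : X → ℝ) : Prop :=
  (∃ A : X →L[ℝ] X, ∀ x, Qf x = ⟪A x, x⟫) ∧
  (∀ (xs : ℕ → X) (x : X), WeakTendsto xs x → Qf x ≤ liminf (fun k => Qf (xs k)) atTop) ∧
  (∀ (xs : ℕ → X) (x : X), WeakTendsto xs x →
     Tendsto (fun k => Qf (xs k)) atTop (𝓝 (Qf x)) → Tendsto xs atTop (𝓝 x))

/-- (A1) for a two-parametric base mapping. -/
def A1two (f : X → P → X) (xb : X) (pb : P) : Prop :=
  ∃ L > (0:ℝ), ∃ ε > (0:ℝ), ∀ x₁ x₂ p₁ p₂,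
    ‖x₁ - xb‖ < ε → ‖x₂ - xb‖ < ε → dist p₁ pb < ε → dist p₂ pb < ε →
    ‖f x₁ p₁ - f x₂ p₂‖ ≤ L * (‖x₁ - x₂‖ + dist p₁ p₂)

/-- (A4) for a two-parametric base mapping. -/
def A4two (f : X → P → X) (Df : X → P → X →L[ℝ] X) (xb : X) (pb : P) : Prop :=
  (∃ η > (0:ℝ), ∀ ε > (0:ℝ), ∃ δ > (0:ℝ), ∀ x p,
      ‖x - xb‖ < η → dist p pb < η →
      ∀ x', ‖x' - x‖ < δ → ‖f x' p - f x p - Df x p (x' - x)‖ ≤ ε * ‖x' - x‖) ∧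
  Tendsto (fun t : X × P => Df t.1 t.2) (𝓝 (xb, pb)) (𝓝 (Df xb pb))

/-- Euclidean distance in X × ℝ. -/
def pairDist (a b : X × ℝ) : ℝ := Real.sqrt (‖a.1 - b.1‖ ^ 2 + |a.2 - b.2| ^ 2)

/-- Pompeiu–Hausdorff distance between subsets of X × ℝ (Euclidean product norm). -/
def hausPH (C₁ C₂ : Set (X × ℝ)) : ℝ :=
  sInf {η : ℝ | 0 ≤ η ∧ (∀ a ∈ C₁, ∃ b ∈ C₂, pairDist a b ≤ η) ∧
                 ∀ b ∈ C₂, ∃ a ∈ C₁, pairDist a b ≤ η}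

/-- Nonparametric prox-regularity with parameter r. -/
def ProxRegWithNP (g : X → EReal) (xb vh : X) (r : ℝ) : Prop :=
  ∃ ε > (0:ℝ), ∀ x u v, ‖x - xb‖ < ε → ‖u - xb‖ < ε → ‖v - vh‖ < ε →
    v ∈ limSubdiff g u → g u ≤ g xb + (ε : EReal) →
    g u + ((⟪v, x - u⟫ - r / 2 * ‖x - u‖ ^ 2 : ℝ) : EReal) ≤ g x

/-- Nonparametric subdifferential continuity. -/
def SubdiffContNP (g : X → EReal) (xb vh : X) : Prop :=
  Tendsto (fun t : X × X => g t.1) (𝓝[gph (limSubdiff g)] (xb, vh)) (𝓝 (g xb))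

/-- Nonparametric threshold of prox-regularity. -/
def proxThresholdNP (g : X → EReal) (xb vh : X) : ℝ :=
  sInf {r : ℝ | 0 < r ∧ ProxRegWithNP g xb vh r}


section WeakConvergence

variable {X : Type*} [NormedAddCommGroup X] [InnerProductSpace ℝ X]

/-- Bounded sequences in a Hilbert space have weakly convergent subsequences. -/
lemma exists_weakTendsto_subseq [CompleteSpace X] {ws : ℕ → X} {M : ℝ} (hM : ∀ k, ‖ws k‖ ≤ M) :
    ∃ (w : X) (φ : ℕ → ℕ), StrictMono φ ∧ WeakTendsto (ws ∘ φ) w := by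
  let S : Submodule ℝ X := (Submodule.span ℝ (Set.range ws)).topologicalClosure
  have hsep : TopologicalSpace.IsSeparable (S : Set X) := by
    rw [Submodule.topologicalClosure_coe]
    exact ((Set.countable_range ws).isSeparable.span (R := ℝ)).closure
  have : TopologicalSpace.SeparableSpace S := hsep.separableSpace
  have : CompleteSpace S :=
    (Submodule.isClosed_topologicalClosure _).completeSpace_coe
  have hmem : ∀ k, ws k ∈ S := fun k =>
    Submodule.le_topologicalClosure _ (Submodule.subset_span ⟨k, rfl⟩)
  let wS : ℕ → S := fun k => ⟨ws k, hmem k⟩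
  obtain ⟨g, -, φ, hφ, hlim⟩ := WeakDual.isSeqCompact_closedBall ℝ S (0 : StrongDual ℝ S) M
    (x := fun k => StrongDual.toWeakDual (InnerProductSpace.toDual ℝ S (wS k)))
    (fun k => by
      change InnerProductSpace.toDual ℝ S (wS k) ∈ Metric.closedBall 0 M
      rw [mem_closedBall_zero_iff, LinearIsometryEquiv.norm_map]
      exact hM k)
  let u : S := (InnerProductSpace.toDual ℝ S).symm (WeakDual.toStrongDual g)
  refine ⟨u, φ, hφ, fun z => ?_⟩
  have h1 := ((WeakDual.eval_continuous (𝕜 := ℝ) (S.orthogonalProjectionOnto z)).tendsto g).comp hlim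
  have h2 : ∀ a : S, ⟪(a : X), z⟫ = ⟪a, S.orthogonalProjectionOnto z⟫ := fun a => by
    simp
  have h3 : g (S.orthogonalProjectionOnto z) = ⟪(u : X), z⟫ := by
    rw [h2, InnerProductSpace.toDual_symm_apply]
    rfl
  rw [← h3]
  refine h1.congr fun k => ?_
  change ⟪wS (φ k), S.orthogonalProjectionOnto z⟫ = ⟪ws (φ k), z⟫
  exact (h2 (wS (φ k))).symm

/-- Closed convex sets are weakly sequentially closed. -/
lemma WeakTendsto.mem_of_convex [CompleteSpace X] {K : Set X} (hcl : IsClosed K)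
    (hcv : Convex ℝ K) {ws : ℕ → X} {w : X} (h : WeakTendsto ws w) (hw : ∀ k, ws k ∈ K) :
    w ∈ K := by
  obtain ⟨u, hu, hmin⟩ := exists_norm_eq_iInf_of_complete_convex ⟨_, hw 0⟩ hcl.isComplete hcv w
  have hvar := (norm_eq_iInf_iff_real_inner_le_zero hcv hu).1 hmin
  have hlim : Tendsto (fun k => ⟪w - u, ws k - u⟫) atTop (𝓝 ⟪w - u, w - u⟫) := by
    have := (h (w - u)).sub (tendsto_const_nhds (x := ⟪u, w - u⟫))
    simp only [← inner_sub_left] at this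
    simpa only [real_inner_comm (w - u)] using this
  have hle : ⟪w - u, w - u⟫ ≤ 0 := le_of_tendsto' hlim fun k => hvar _ (hw k)
  rw [real_inner_self_eq_norm_sq] at hle
  have : w - u = 0 :=
    norm_eq_zero.1 ((pow_eq_zero_iff two_ne_zero).1 (le_antisymm hle (sq_nonneg _)))
  rwa [sub_eq_zero.1 this]

/-- If `zs → z` strongly and `ws ⇀ w` weakly with `ws` bounded, then `⟪zs, ws⟫ → ⟪z, w⟫`. -/
lemma WeakTendsto.inner_tendsto {ws zs : ℕ → X} {w z : X} {M : ℝ} (h : WeakTendsto ws w)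
    (hM : ∀ k, ‖ws k‖ ≤ M) (hz : Tendsto zs atTop (𝓝 z)) :
    Tendsto (fun k => ⟪zs k, ws k⟫) atTop (𝓝 ⟪z, w⟫) := by
  have h1 : Tendsto (fun k => ⟪zs k - z, ws k⟫) atTop (𝓝 0) := by
    have hn : Tendsto (fun k => ‖zs k - z‖ * M) atTop (𝓝 0) := by
      simpa using (tendsto_iff_norm_sub_tendsto_zero.1 hz).mul_const M
    refine squeeze_zero_norm (fun k => ?_) hn
    exact (norm_inner_le_norm _ _).trans (mul_le_mul_of_nonneg_left (hM k) (norm_nonneg _))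
  have h2 := h1.add (h z)
  simp only [zero_add] at h2
  rw [real_inner_comm]
  refine h2.congr fun k => ?_
  rw [inner_sub_left, real_inner_comm z]
  ring

/-- Nonnegative quadratic forms are weakly sequentially lower semicontinuous. -/
lemma WeakTendsto.inner_map_le_of_tendsto [CompleteSpace X] {B : X →L[ℝ] X}
    (hB : ∀ w, 0 ≤ ⟪B w, w⟫) {ws : ℕ → X} {w : X} (h : WeakTendsto ws w) {b : ℕ → ℝ} {b₀ : ℝ}
    (hb : Tendsto b atTop (𝓝 b₀)) (hle : ∀ k, ⟪B (ws k), ws k⟫ ≤ b k) : ⟪B w, w⟫ ≤ b₀ := by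
  have h1 : Tendsto (fun k => ⟪B (ws k), w⟫) atTop (𝓝 ⟪B w, w⟫) := by
    simpa only [ContinuousLinearMap.adjoint_inner_right] using h (B.adjoint w)
  have h2 : Tendsto (fun k => ⟪ws k, B w⟫) atTop (𝓝 ⟪B w, w⟫) := by
    simpa only [real_inner_comm w] using h (B w)
  have h3 : Tendsto (fun k => ⟪B (ws k), w⟫ + ⟪ws k, B w⟫ - ⟪B w, w⟫) atTop (𝓝 ⟪B w, w⟫) := by
    simpa using (h1.add h2).sub_const ⟪B w, w⟫
  refine le_of_tendsto_of_tendsto' h3 hb fun k => le_trans ?_ (hle k)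
  have := hB (ws k - w)
  simp only [map_sub, inner_sub_left, inner_sub_right] at this
  rw [real_inner_comm (B w) (ws k)]
  linarith

end WeakConvergence

section Cones

variable {X : Type*} [NormedAddCommGroup X] [InnerProductSpace ℝ X]

lemma add_smul_mem_of_le {C : Set X} (hC : Convex ℝ C) {x w : X} (hx : x ∈ C) {s t : ℝ}
    (hs : 0 ≤ s) (hst : s ≤ t) (h : x + t • w ∈ C) : x + s • w ∈ C := by
  rcases hs.eq_or_lt with rfl | hs
  · simpa using hx
  have ht : 0 < t := hs.trans_le hst
  have := hC.add_smul_mem hx h (t := s / t) ⟨by positivity, (div_le_one ht).2 hst⟩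
  rwa [smul_smul, div_mul_cancel₀ _ ht.ne'] at this

lemma convex_radialCone {C : Set X} (hC : Convex ℝ C) {x : X} (hx : x ∈ C) :
    Convex ℝ (radialCone C x) := by
  rintro w₁ ⟨t₁, ht₁, h₁⟩ w₂ ⟨t₂, ht₂, h₂⟩ a b ha hb hab
  refine ⟨min t₁ t₂, lt_min ht₁ ht₂, ?_⟩
  have h₁' := add_smul_mem_of_le hC hx (lt_min ht₁ ht₂).le (min_le_left _ _) h₁
  have h₂' := add_smul_mem_of_le hC hx (lt_min ht₁ ht₂).le (min_le_right _ _) h₂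
  convert hC h₁' h₂' ha hb hab using 1
  have : x = (a + b) • x := by rw [hab, one_smul]
  nth_rewrite 1 [this]
  module

lemma smul_mem_criticalCone {C : Set X} {x v w : X} (hw : w ∈ criticalCone C x v) {s : ℝ}
    (hs : 0 < s) : s • w ∈ criticalCone C x v := by
  refine ⟨map_mem_closure (continuous_const_smul s) hw.1 ?_, ?_⟩
  · rintro u ⟨t, ht, hu⟩
    refine ⟨t / s, by positivity, ?_⟩
    rwa [smul_smul, div_mul_cancel₀ _ hs.ne']
  · have : ⟪v, w⟫ = 0 := hw.2
    simp [inner_smul_right, this]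

lemma convNC_monotone {C : Set X} {x₁ x₂ v₁ v₂ : X} (h₁ : v₁ ∈ convNC C x₁)
    (h₂ : v₂ ∈ convNC C x₂) : 0 ≤ ⟪v₁ - v₂, x₁ - x₂⟫ := by
  have a := h₁.2 x₂ h₂.1
  have b := h₂.2 x₁ h₁.1
  rw [← neg_sub x₁ x₂, inner_neg_right] at a
  rw [inner_sub_left]
  linarith

/-- Moving from `x` along a radial direction orthogonal to a normal keeps the normal. -/
lemma convNC_add_smul {C : Set X} {x v w : X} {t : ℝ} (hv : v ∈ convNC C x) (hw : ⟪v, w⟫ = 0)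
    (ht : x + t • w ∈ C) : v ∈ convNC C (x + t • w) := by
  refine ⟨ht, fun y hy => ?_⟩
  have := hv.2 y hy
  rwa [← sub_sub, inner_sub_right, inner_smul_right, hw, mul_zero, sub_zero]

end Cones

section Resolvent

variable {X : Type*} [NormedAddCommGroup X] [InnerProductSpace ℝ X]

/-- `R` is the (everywhere defined, single-valued) inverse of `B + N_C`. -/
def IsResolvent (C : Set X) (B : X →L[ℝ] X) (R : X → X) : Prop :=
  ∀ y r, y - B r ∈ convNC C r ↔ r = R y

lemma norm_sub_le_of_inner {c : ℝ} (hc : 0 < c) {a b : X} (h : c * ‖a‖ ^ 2 ≤ ⟪b, a⟫) :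
    ‖a‖ ≤ ‖b‖ / c := by
  rcases (norm_nonneg a).eq_or_lt with h0 | h0
  · rw [← h0]; positivity
  rw [le_div_iff₀ hc]
  have h2 := h.trans (real_inner_le_norm b a)
  nlinarith

lemma inner_add_smul_id (A : X →L[ℝ] X) (μ : ℝ) (w : X) :
    ⟪(A + μ • ContinuousLinearMap.id ℝ X) w, w⟫ = ⟪A w, w⟫ + μ * ‖w‖ ^ 2 := by
  simp only [add_apply, smul_apply, ContinuousLinearMap.id_apply, inner_add_left,
    real_inner_smul_left, real_inner_self_eq_norm_sq]

lemma mul_norm_sq_le_inner_add_smul_id (A : X →L[ℝ] X) (μ : ℝ) (w : X) :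
    (μ - ‖A‖) * ‖w‖ ^ 2 ≤ ⟪(A + μ • ContinuousLinearMap.id ℝ X) w, w⟫ := by
  have h1 := neg_le_of_abs_le (abs_real_inner_le_norm (A w) w)
  have h2 := mul_le_mul_of_nonneg_right (A.le_opNorm w) (norm_nonneg w)
  rw [inner_add_smul_id]
  nlinarith

/-- Strongly monotone resolvents exist for large shifts of a bounded operator. -/
lemma exists_isResolvent [CompleteSpace X] {C : Set X} (hne : C.Nonempty) (hcl : IsClosed C)
    (hcv : Convex ℝ C) (A : X →L[ℝ] X) {μ : ℝ} (hμ : ‖A‖ < μ) :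
    ∃ R, IsResolvent C (A + μ • ContinuousLinearMap.id ℝ X) R := by
  have hμ0 : 0 < μ := (norm_nonneg A).trans_lt hμ
  have hproj : ∀ u : X, ∃ r ∈ C, ∀ y ∈ C, ⟪u - r, y - r⟫ ≤ 0 := fun u => by
    obtain ⟨r, hr, hmin⟩ := exists_norm_eq_iInf_of_complete_convex hne hcl.isComplete hcv u
    exact ⟨r, hr, (norm_eq_iInf_iff_real_inner_le_zero hcv hr).1 hmin⟩
  choose π hπC hπ using hproj
  have hnonexp : ∀ a b, ‖π a - π b‖ ≤ ‖a - b‖ := fun a b => by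
    have h := convNC_monotone (C := C) (x₁ := π a) (x₂ := π b) ⟨hπC a, hπ a⟩ ⟨hπC b, hπ b⟩
    have h' : (1 : ℝ) * ‖π a - π b‖ ^ 2 ≤ ⟪a - b, π a - π b⟫ := by
      rw [one_mul, ← real_inner_self_eq_norm_sq, ← sub_nonneg, ← inner_sub_left]
      convert h using 2
      abel
    simpa using norm_sub_le_of_inner one_pos h'
  have hex : ∀ y, ∃ r, y - (A + μ • ContinuousLinearMap.id ℝ X) r ∈ convNC C r := fun y => by
    have hK : ContractingWith (‖A‖ / μ).toNNReal (fun r => π (μ⁻¹ • (y - A r))) := by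
      refine ⟨?_, LipschitzWith.of_dist_le_mul fun a b => ?_⟩
      · exact Real.toNNReal_lt_one.2 ((div_lt_one hμ0).2 hμ)
      · rw [dist_eq_norm, dist_eq_norm, Real.coe_toNNReal _ (by positivity)]
        refine (hnonexp _ _).trans ?_
        rw [← smul_sub, norm_smul, norm_inv, Real.norm_of_nonneg hμ0.le]
        have : y - A a - (y - A b) = A (b - a) := by rw [map_sub]; abel
        rw [this]
        have h1 := A.le_opNorm (b - a)
        rw [norm_sub_rev b a] at h1
        calc μ⁻¹ * ‖A (b - a)‖ ≤ μ⁻¹ * (‖A‖ * ‖a - b‖) := by gcongr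
          _ = ‖A‖ / μ * ‖a - b‖ := by ring
    have hfix : π (μ⁻¹ • (y - A (hK.fixedPoint _))) = hK.fixedPoint _ := hK.fixedPoint_isFixedPt
    set r := hK.fixedPoint _
    refine ⟨r, hfix ▸ hπC _, fun z hz => ?_⟩
    have h := hπ (μ⁻¹ • (y - A r)) z hz
    rw [hfix] at h
    have h2 : y - (A + μ • ContinuousLinearMap.id ℝ X) r = μ • (μ⁻¹ • (y - A r) - r) := by
      rw [smul_sub, smul_inv_smul₀ hμ0.ne']
      simp [sub_sub]
    rw [h2, real_inner_smul_left]
    exact mul_nonpos_of_nonneg_of_nonpos hμ0.le h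
  choose R hR using hex
  refine ⟨R, fun y r => ⟨fun h => ?_, fun h => h ▸ hR y⟩⟩
  have hmono := convNC_monotone h (hR y)
  have h3 := mul_norm_sq_le_inner_add_smul_id A μ (r - R y)
  have h4 : y - (A + μ • ContinuousLinearMap.id ℝ X) r
      - (y - (A + μ • ContinuousLinearMap.id ℝ X) (R y))
      = -(A + μ • ContinuousLinearMap.id ℝ X) (r - R y) := by
    rw [map_sub]; abel
  rw [h4, inner_neg_left] at hmono
  have h5 : ‖r - R y‖ ≤ ‖(0 : X)‖ / (μ - ‖A‖) :=
    norm_sub_le_of_inner (sub_pos.2 hμ) (by rw [inner_zero_left]; linarith)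
  rw [norm_zero, zero_div] at h5
  exact sub_eq_zero.1 (norm_le_zero_iff.1 h5)

lemma IsResolvent.mem {C : Set X} {B : X →L[ℝ] X} {R : X → X} (h : IsResolvent C B R) (y : X) :
    y - B (R y) ∈ convNC C (R y) := (h y _).2 rfl

lemma IsResolvent.inner_map_le {C : Set X} {B : X →L[ℝ] X} {R : X → X} (h : IsResolvent C B R)
    (y y' : X) : ⟪B (R y - R y'), R y - R y'⟫ ≤ ⟪y - y', R y - R y'⟫ := by
  have := convNC_monotone (h.mem y) (h.mem y')
  have h4 : y - B (R y) - (y' - B (R y')) = (y - y') - B (R y - R y') := by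
    rw [map_sub]; abel
  rw [h4, inner_sub_left] at this
  linarith

lemma IsResolvent.norm_sub_le {C : Set X} {B : X →L[ℝ] X} {R : X → X} (h : IsResolvent C B R)
    {m : ℝ} (hm : 0 < m) (hB : ∀ w, m * ‖w‖ ^ 2 ≤ ⟪B w, w⟫) (y y' : X) :
    ‖R y - R y'‖ ≤ ‖y - y'‖ / m :=
  norm_sub_le_of_inner hm ((hB _).trans (h.inner_map_le y y'))

lemma IsResolvent.continuous {C : Set X} {B : X →L[ℝ] X} {R : X → X} (h : IsResolvent C B R)
    {m : ℝ} (hm : 0 < m) (hB : ∀ w, m * ‖w‖ ^ 2 ≤ ⟪B w, w⟫) : Continuous R := by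
  refine (LipschitzWith.of_dist_le_mul (K := (1 / m).toNNReal) fun a b => ?_).continuous
  rw [dist_eq_norm, dist_eq_norm, Real.coe_toNNReal _ (by positivity)]
  exact (h.norm_sub_le hm hB a b).trans_eq (by ring)

/-- Weak one-sided directional derivatives of the resolvent lie in the critical cone. -/
lemma IsResolvent.exists_weak_deriv [CompleteSpace X] {C : Set X} (hcv : Convex ℝ C)
    {B : X →L[ℝ] X} {R : X → X} (h : IsResolvent C B R) {m : ℝ} (hm : 0 < m)
    (hB : ∀ w, m * ‖w‖ ^ 2 ≤ ⟪B w, w⟫) (y d : X) :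
    ∃ w ∈ criticalCone C (R y) (y - B (R y)), ⟪B w, w⟫ ≤ ⟪d, w⟫ ∧
      ∃ s : ℕ → ℝ, (∀ k, 0 < s k) ∧ Tendsto s atTop (𝓝 0) ∧
        WeakTendsto (fun k => (s k)⁻¹ • (R (y + s k • d) - R y)) w := by
  let s₀ : ℕ → ℝ := fun k => 1 / ((k : ℝ) + 1)
  have hs₀ : ∀ k, 0 < s₀ k := fun k => Nat.one_div_pos_of_nat
  obtain ⟨q, hqdef⟩ : ∃ q : ℝ → X, ∀ s, q s = s⁻¹ • (R (y + s • d) - R y) := ⟨_, fun _ => rfl⟩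
  have hq : ∀ s, 0 < s → ‖q s‖ ≤ ‖d‖ / m := fun s hs => by
    have h1 := h.norm_sub_le hm hB (y + s • d) y
    rw [add_sub_cancel_left, norm_smul, Real.norm_of_nonneg hs.le] at h1
    rw [hqdef, norm_smul, norm_inv, Real.norm_of_nonneg hs.le, inv_mul_le_iff₀ hs]
    exact h1.trans_eq (by ring)
  obtain ⟨w, φ, hφ, hw⟩ := exists_weakTendsto_subseq (ws := fun k => q (s₀ k))
    (fun k => hq _ (hs₀ k))
  let s : ℕ → ℝ := s₀ ∘ φ
  have hs : ∀ k, 0 < s k := fun k => hs₀ _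
  have hslim : Tendsto s atTop (𝓝 0) :=
    tendsto_one_div_add_atTop_nhds_zero_nat.comp hφ.tendsto_atTop
  have hw' : WeakTendsto (fun k => q (s k)) w := hw
  have hRq : ∀ k, R (y + s k • d) - R y = s k • q (s k) := fun k => by
    rw [hqdef, smul_inv_smul₀ (hs k).ne']
  have hylim : Tendsto (fun k => y + s k • d) atTop (𝓝 y) := by
    simpa using (hslim.smul_const d).const_add y
  have hRlim : Tendsto (fun k => R (y + s k • d)) atTop (𝓝 (R y)) := by
    rw [tendsto_iff_norm_sub_tendsto_zero]
    refine squeeze_zero (fun _ => norm_nonneg _) (fun k => h.norm_sub_le hm hB _ _) ?_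
    simpa using (tendsto_iff_norm_sub_tendsto_zero.1 hylim).div_const m
  have hmem := h.mem y
  refine ⟨w, ⟨?_, ?_⟩, ?_, s, hs, hslim, by simpa only [hqdef] using hw'⟩
  · refine hw'.mem_of_convex isClosed_closure (convex_radialCone hcv hmem.1).closure fun k => ?_
    refine subset_closure ⟨s k, hs k, ?_⟩
    rw [← hRq, add_sub_cancel]
    exact (h.mem _).1
  · apply le_antisymm
    · refine le_of_tendsto' (hw'.inner_tendsto (fun k => hq _ (hs k)) tendsto_const_nhds)
        fun k => ?_
      have h1 := hmem.2 _ (h.mem (y + s k • d)).1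
      rw [hRq, real_inner_smul_right] at h1
      exact nonpos_of_mul_nonpos_right h1 (hs k)
    · have hnlim : Tendsto (fun k => (y + s k • d) - B (R (y + s k • d))) atTop
          (𝓝 (y - B (R y))) := hylim.sub ((B.continuous.tendsto _).comp hRlim)
      refine ge_of_tendsto' (hw'.inner_tendsto (fun k => hq _ (hs k)) hnlim) fun k => ?_
      have h1 := (h.mem (y + s k • d)).2 _ hmem.1
      rw [← neg_sub (R (y + s k • d)) (R y), hRq, inner_neg_right,
        real_inner_smul_right, neg_nonpos] at h1
      exact nonneg_of_mul_nonneg_right h1 (hs k)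
  · refine hw'.inner_map_le_of_tendsto (fun u => le_trans (by positivity) (hB u))
      (hw'.inner_tendsto (fun k => hq _ (hs k)) (tendsto_const_nhds (x := d))) fun k => ?_
    have h1 := h.inner_map_le (y + s k • d) y
    rw [hRq, add_sub_cancel_left, map_smul, real_inner_smul_left, real_inner_smul_left,
      real_inner_smul_right, real_inner_smul_right] at h1
    have h2 := hs k
    exact le_of_mul_le_mul_left (le_of_mul_le_mul_left h1 h2) h2

/-- Coercivity of `B` on the critical cones met along a segment yields the corresponding strong
monotonicity of the resolvent between its end points. -/
lemma IsResolvent.strong_mono_of_segment [CompleteSpace X] {C : Set X} (hcv : Convex ℝ C)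
    {B : X →L[ℝ] X} {R : X → X} (h : IsResolvent C B R) {m : ℝ} (hm : 0 < m)
    (hB : ∀ w, m * ‖w‖ ^ 2 ≤ ⟪B w, w⟫) {c : ℝ} (hc : 0 ≤ c) {y y' : X}
    (hcrit : ∀ z ∈ segment ℝ y y', ∀ w ∈ criticalCone C (R z) (z - B (R z)),
      c * ‖w‖ ^ 2 ≤ ⟪B w, w⟫) :
    c * ‖R y' - R y‖ ^ 2 ≤ ⟪y' - y, R y' - R y⟫ := by
  set d := y' - y with hd
  set Δ := R y' - R y with hΔ
  have hcont : Continuous R := h.continuous hm hB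
  let θ : ℝ → ℝ := fun t => ⟪(2 * c) • Δ - d, R (y + t • d)⟫
  have hθ : Continuous θ := by fun_prop
  have hbd := image_le_of_liminf_slope_right_le_deriv_boundary (f := θ) (a := 0) (b := 1)
    hθ.continuousOn (B := fun t => θ 0 + c * ‖Δ‖ ^ 2 * t) (B' := fun _ => c * ‖Δ‖ ^ 2)
    (by simp) (by fun_prop)
    (fun x _ => by
      simpa using (((hasDerivAt_id x).const_mul (c * ‖Δ‖ ^ 2)).const_add (θ 0)).hasDerivWithinAt)
    (fun t ht r hr => by
      obtain ⟨w, hw, hwd, s, hs, hslim, hweak⟩ := h.exists_weak_deriv hcv hm hB (y + t • d) d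
      have hz : y + t • d ∈ segment ℝ y y' := by
        rw [segment_eq_image']
        exact ⟨t, ⟨ht.1, ht.2.le⟩, rfl⟩
      have hcw := (hcrit _ hz w hw).trans hwd
      have hlt : ⟪w, (2 * c) • Δ - d⟫ < r := by
        refine lt_of_le_of_lt ?_ hr
        have hsq : 0 ≤ ‖Δ - w‖ ^ 2 := by positivity
        rw [norm_sub_sq_real] at hsq
        rw [inner_sub_right, real_inner_smul_right, real_inner_comm d w, real_inner_comm Δ w]
        nlinarith
      have hev : ∀ᶠ k in atTop, slope θ t (t + s k) < r := by
        filter_upwards [(hweak ((2 * c) • Δ - d)).eventually_lt_const hlt] with k hk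
        refine lt_of_eq_of_lt ?_ hk
        simp only [slope_def_field, θ]
        rw [real_inner_smul_left, real_inner_comm ((2 * c) • Δ - d),
          inner_sub_right ((2 * c) • Δ - d), add_sub_cancel_left, add_smul, ← add_assoc]
        ring
      have htend : Tendsto (fun k => t + s k) atTop (𝓝[>] t) := by
        refine tendsto_nhdsWithin_iff.2 ⟨?_, Eventually.of_forall fun k => ?_⟩
        · simpa using hslim.const_add t
        · simpa using hs k
      exact htend.frequently hev.frequently)
    (right_mem_Icc.2 zero_le_one)
  have hyd : y + d = y' := by rw [hd]; abel
  simp only [θ, one_smul, zero_smul, add_zero, mul_one, hyd] at hbd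
  have h1 : ⟪(2 * c) • Δ - d, Δ⟫ ≤ c * ‖Δ‖ ^ 2 := by
    nth_rewrite 2 [hΔ]
    rw [inner_sub_right]
    linarith
  rw [inner_sub_left, real_inner_smul_left, real_inner_self_eq_norm_sq] at h1
  linarith

end Resolvent

section VariationalInequality

variable {X : Type*} [NormedAddCommGroup X] [InnerProductSpace ℝ X]
variable {P : Type*} [MetricSpace P]

/-- Uniform differentiability with a continuous derivative gives uniform strict
differentiability. -/
lemma A4two.strict {f : X → P → X} {Df : X → P → X →L[ℝ] X} {xb : X} {pb : P}
    (h : A4two f Df xb pb) {ε : ℝ} (hε : 0 < ε) :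
    ∃ δ > 0, ∀ x x' p, ‖x - xb‖ < δ → ‖x' - xb‖ < δ → dist p pb < δ →
      ‖f x p - f x' p - Df xb pb (x - x')‖ ≤ ε * ‖x - x'‖ := by
  obtain ⟨⟨η, hη, hunif⟩, hcont⟩ := h
  obtain ⟨δ₁, hδ₁, h₁⟩ := hunif (ε / 2) (by positivity)
  obtain ⟨δ₂, hδ₂, h₂⟩ := Metric.tendsto_nhds_nhds.1 hcont (ε / 2) (by positivity)
  refine ⟨min η (min (δ₁ / 2) δ₂), by positivity, fun x x' p hx hx' hp => ?_⟩
  simp only [lt_min_iff] at hx hx' hp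
  have hxx : ‖x - x'‖ < δ₁ := by
    have := norm_sub_le_norm_sub_add_norm_sub x xb x'
    rw [norm_sub_rev xb x'] at this
    linarith [hx.2.1, hx'.2.1]
  have ha := h₁ x' p hx'.1 hp.1 x hxx
  have hb : ‖Df x' p - Df xb pb‖ < ε / 2 := by
    have := h₂ (x := (x', p)) (by
      rw [Prod.dist_eq, dist_eq_norm]
      exact max_lt hx'.2.2 hp.2.2)
    rwa [dist_eq_norm] at this
  have hc := (Df x' p - Df xb pb).le_of_opNorm_le hb.le (x - x')
  have hd : f x p - f x' p - Df xb pb (x - x') =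
      (f x p - f x' p - Df x' p (x - x')) + (Df x' p - Df xb pb) (x - x') := by
    simp only [sub_apply]; abel
  rw [hd]
  refine (norm_add_le _ _).trans ?_
  linarith

/-- A Legendre form that is positive on weak limits of critical directions is uniformly coercive
on all nearby critical cones. -/
lemma exists_coercive_of_legendreForm [CompleteSpace X] {C : Set X} {A : X →L[ℝ] X} {xb vh : X}
    (hleg : LegendreForm fun w => ⟪A w, w⟫) (hpos : ∀ w ∈ Hw C xb vh, w ≠ 0 → 0 < ⟪A w, w⟫) :
    ∃ κ > 0, ∃ η > 0, ∀ x v, v ∈ convNC C x → ‖x - xb‖ < η → ‖v - vh‖ < η →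
      ∀ w ∈ criticalCone C x v, κ * ‖w‖ ^ 2 ≤ ⟪A w, w⟫ := by
  by_contra! hcon
  choose xs vs hN hxs hvs us hus hlt using fun k : ℕ =>
    hcon (1 / ((k : ℝ) + 1)) Nat.one_div_pos_of_nat (1 / ((k : ℝ) + 1)) Nat.one_div_pos_of_nat
  have hlim0 := tendsto_one_div_add_atTop_nhds_zero_nat (𝕜 := ℝ)
  have hus0 : ∀ k, 0 < ‖us k‖ := fun k => norm_pos_iff.2 fun h0 => by
    have := hlt k
    simp [h0] at this
  let ws : ℕ → X := fun k => ‖us k‖⁻¹ • us k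
  have hwn : ∀ k, ‖ws k‖ = 1 := fun k => by
    simp only [ws, norm_smul, norm_inv, norm_norm]
    exact inv_mul_cancel₀ (hus0 k).ne'
  have hwlt : ∀ k, ⟪A (ws k), ws k⟫ ≤ 1 / ((k : ℝ) + 1) := fun k => by
    simp only [ws, map_smul, real_inner_smul_left, real_inner_smul_right]
    rw [inv_mul_le_iff₀ (hus0 k), inv_mul_le_iff₀ (hus0 k)]
    exact (hlt k).le.trans_eq (by ring)
  obtain ⟨w, φ, hφ, hw⟩ := exists_weakTendsto_subseq (ws := ws) fun k => (hwn k).le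
  have hwH : w ∈ Hw C xb vh := by
    refine ⟨xs ∘ φ, vs ∘ φ, ws ∘ φ, fun k => hN _, ?_, ?_, fun k => ?_, hw⟩
    · refine Tendsto.comp ?_ hφ.tendsto_atTop
      rw [tendsto_iff_norm_sub_tendsto_zero]
      exact squeeze_zero (fun _ => norm_nonneg _) (fun k => (hxs k).le) hlim0
    · refine Tendsto.comp ?_ hφ.tendsto_atTop
      rw [tendsto_iff_norm_sub_tendsto_zero]
      exact squeeze_zero (fun _ => norm_nonneg _) (fun k => (hvs k).le) hlim0
    · exact smul_mem_criticalCone (hus _) (inv_pos.2 (hus0 _))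
  obtain ⟨-, hlsc, hstrong⟩ := hleg
  let Q : ℕ → ℝ := fun k => ⟪A ((ws ∘ φ) k), (ws ∘ φ) k⟫
  have hQabs : ∀ k, |Q k| ≤ ‖A‖ := fun k => by
    refine (abs_real_inner_le_norm _ _).trans ?_
    have h1 := hwn (φ k)
    have h2 := A.le_opNorm (ws (φ k))
    simp only [Function.comp_apply]
    rw [h1, mul_one] at *
    exact h2
  have hbelow : IsBoundedUnder (· ≥ ·) atTop Q :=
    isBoundedUnder_of ⟨-‖A‖, fun k => neg_le_of_abs_le (hQabs k)⟩
  have habove : IsBoundedUnder (· ≤ ·) atTop Q :=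
    isBoundedUnder_of ⟨‖A‖, fun k => le_of_abs_le (hQabs k)⟩
  have hsup : limsup Q atTop ≤ 0 := by
    have hl : Tendsto (fun k => 1 / ((φ k : ℝ) + 1)) atTop (𝓝 0) := hlim0.comp hφ.tendsto_atTop
    rw [← hl.limsup_eq]
    exact limsup_le_limsup (Eventually.of_forall fun k => hwlt (φ k)) hbelow.isCoboundedUnder_le
      hl.isBoundedUnder_le
  have hinf : ⟪A w, w⟫ ≤ liminf Q atTop := hlsc _ _ hw
  have hw0 : w = 0 := by
    by_contra hne
    have := hpos w hwH hne
    have := liminf_le_limsup habove hbelow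
    linarith
  subst hw0
  have hQ0 : Tendsto Q atTop (𝓝 0) :=
    tendsto_of_le_liminf_of_limsup_le (by simpa using hinf) hsup habove hbelow
  have hstr := (hstrong _ _ hw (by simpa only [map_zero, inner_zero_left] using hQ0)).norm
  simp only [Function.comp_apply, hwn, norm_zero] at hstr
  exact one_ne_zero (tendsto_nhds_unique tendsto_const_nhds hstr)

/-- Uniform coercivity on nearby critical cones gives local strong monotonicity of the resolvent
of `A + μ + N_C`. -/
lemma IsResolvent.exists_local_strong_mono [CompleteSpace X] {C : Set X} (hcv : Convex ℝ C)
    {A : X →L[ℝ] X} {μ : ℝ} (hμ : ‖A‖ < μ) {R : X → X}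
    (hR : IsResolvent C (A + μ • ContinuousLinearMap.id ℝ X) R) {xb vh : X}
    (hvh : vh ∈ convNC C xb) {κ η : ℝ} (hκ : 0 < κ) (hη : 0 < η)
    (hco : ∀ x v, v ∈ convNC C x → ‖x - xb‖ < η → ‖v - vh‖ < η →
      ∀ w ∈ criticalCone C x v, κ * ‖w‖ ^ 2 ≤ ⟪A w, w⟫) :
    ∃ ρ > 0, ∀ y y', ‖y - (vh + (A + μ • ContinuousLinearMap.id ℝ X) xb)‖ < ρ →
      ‖y' - (vh + (A + μ • ContinuousLinearMap.id ℝ X) xb)‖ < ρ →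
      (κ + μ) * ‖R y - R y'‖ ^ 2 ≤ ⟪y - y', R y - R y'⟫ := by
  have hμ0 : 0 < μ := (norm_nonneg A).trans_lt hμ
  have hBid := inner_add_smul_id A μ
  have hB := mul_norm_sq_le_inner_add_smul_id A μ
  set B := A + μ • ContinuousLinearMap.id ℝ X
  set yb := vh + B xb with hyb
  have hm : 0 < μ - ‖A‖ := sub_pos.2 hμ
  have hRb : R yb = xb := ((hR yb xb).1 (by rwa [hyb, add_sub_cancel_right])).symm
  have hcont : Continuous R := hR.continuous hm hB
  have e1 : ∀ᶠ z in 𝓝 yb, ‖R z - xb‖ < η := by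
    have : Continuous fun z => ‖R z - xb‖ := by fun_prop
    exact this.continuousAt.eventually_lt_const (by simpa [hRb] using hη)
  have e2 : ∀ᶠ z in 𝓝 yb, ‖z - B (R z) - vh‖ < η := by
    have : Continuous fun z => ‖z - B (R z) - vh‖ := by fun_prop
    exact this.continuousAt.eventually_lt_const (by
      beta_reduce
      rw [hRb, hyb, add_sub_cancel_right, sub_self, norm_zero]
      exact hη)
  obtain ⟨ρ, hρ, hball⟩ := Metric.eventually_nhds_iff_ball.1 (e1.and e2)
  refine ⟨ρ, hρ, fun y y' hy hy' => ?_⟩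
  refine hR.strong_mono_of_segment hcv hm hB (by positivity) fun z hz w hw => ?_
  have hzb : z ∈ Metric.ball yb ρ := (convex_ball yb ρ).segment_subset
    (mem_ball_iff_norm.2 hy') (mem_ball_iff_norm.2 hy) hz
  have := hco _ _ (hR.mem z) (hball z hzb).1 (hball z hzb).2 w hw
  rw [hBid]
  linarith

/-- Uniform coercivity on nearby critical cones implies full stability. -/
lemma fullStable2_of_coercive [CompleteSpace X] {f : X → P → X} {Df : X → P → X →L[ℝ] X}
    {C : Set X} (hne : C.Nonempty) (hcl : IsClosed C) (hcv : Convex ℝ C) {xb vb : X} {pb : P}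
    (hsol : vb - f xb pb ∈ convNC C xb) (hA1 : A1two f xb pb) (hA4 : A4two f Df xb pb)
    {κ η : ℝ} (hκ : 0 < κ) (hη : 0 < η)
    (hco : ∀ x v, v ∈ convNC C x → ‖x - xb‖ < η → ‖v - (vb - f xb pb)‖ < η →
      ∀ w ∈ criticalCone C x v, κ * ‖w‖ ^ 2 ≤ ⟪Df xb pb w, w⟫) :
    FullStable2 (SolMapVI f C) xb vb pb := by
  obtain ⟨μ, hμ⟩ := exists_gt ‖Df xb pb‖
  have hμ0 : 0 < μ := (norm_nonneg _).trans_lt hμ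
  obtain ⟨R, hR⟩ := exists_isResolvent hne hcl hcv (Df xb pb) hμ
  obtain ⟨ρ, hρ, hmono⟩ := hR.exists_local_strong_mono hcv hμ hsol hκ hη hco
  obtain ⟨δ₁, hδ₁, hstrict⟩ := hA4.strict (half_pos hκ)
  obtain ⟨L, hL, δ₂, hδ₂, hlip⟩ := hA1
  set A := Df xb pb
  set B := A + μ • ContinuousLinearMap.id ℝ X
  set yb := vb - f xb pb + B xb with hyb
  have hRb : R yb = xb := ((hR yb xb).1 (by rwa [hyb, add_sub_cancel_right])).symm
  have hBapp : ∀ w, B w = A w + μ • w := fun w => by simp [B]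
  set c := κ + μ with hc
  have hc0 : 0 < c := by positivity
  obtain ⟨δ, hδ, hδle⟩ : ∃ δ > 0, δ < δ₁ ∧ δ < δ₂ ∧ c * δ < ρ := by
    refine ⟨min (δ₁ / 2) (min (δ₂ / 2) (ρ / (2 * c))), by positivity, ?_, ?_, ?_⟩
    · exact (min_le_left _ _).trans_lt (by linarith)
    · exact ((min_le_right _ _).trans (min_le_left _ _)).trans_lt (by linarith)
    · have h1 : min (δ₁ / 2) (min (δ₂ / 2) (ρ / (2 * c))) ≤ ρ / (2 * c) :=
        (min_le_right _ _).trans (min_le_right _ _)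
      calc c * min (δ₁ / 2) (min (δ₂ / 2) (ρ / (2 * c))) ≤ c * (ρ / (2 * c)) := by gcongr
        _ = ρ / 2 := by field_simp
        _ < ρ := by linarith
  obtain ⟨hδ1, hδ2, hδρ⟩ := hδle
  obtain ⟨τ, hτ, hτ1, hτ2, hτ3⟩ : ∃ τ > 0, τ < δ₁ ∧ τ < δ₂ ∧ (1 + L) * τ ≤ κ / 2 * δ := by
    refine ⟨min (δ₁ / 2) (min (δ₂ / 2) (κ / 2 * δ / (1 + L))), by positivity, ?_, ?_, ?_⟩
    · exact (min_le_left _ _).trans_lt (by linarith)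
    · exact ((min_le_right _ _).trans (min_le_left _ _)).trans_lt (by linarith)
    · have h1 : min (δ₁ / 2) (min (δ₂ / 2) (κ / 2 * δ / (1 + L))) ≤ κ / 2 * δ / (1 + L) :=
        (min_le_right _ _).trans (min_le_right _ _)
      calc _ ≤ (1 + L) * (κ / 2 * δ / (1 + L)) := by gcongr
        _ = κ / 2 * δ := by field_simp
  let g : X → P → X → X := fun v p x => v - f x p + B x
  have hgb : ∀ v p x, ‖v - vb‖ < τ → dist p pb < τ → ‖x - xb‖ ≤ δ → ‖g v p x - yb‖ ≤ c * δ := by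
    intro v p x hv hp hx
    have s1 := hstrict x xb p (by linarith) (by simpa) (by linarith)
    have s2 := hlip xb xb p pb (by simpa) (by simpa) (by linarith) (by simpa)
    rw [sub_self, norm_zero, zero_add] at s2
    have hdec : g v p x - yb = (v - vb) - (f x p - f xb p - A (x - xb)) - (f xb p - f xb pb)
        + μ • (x - xb) := by
      simp only [g, hyb, hBapp, map_sub, smul_sub]
      abel
    rw [hdec]
    refine (norm_add_le _ _).trans ?_
    have t1 := norm_sub_le ((v - vb) - (f x p - f xb p - A (x - xb))) (f xb p - f xb pb)
    have t2 := norm_sub_le (v - vb) (f x p - f xb p - A (x - xb))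
    rw [norm_smul, Real.norm_of_nonneg hμ0.le]
    have t3 : κ / 2 * ‖x - xb‖ ≤ κ / 2 * δ := by gcongr
    have t4 : μ * ‖x - xb‖ ≤ μ * δ := by gcongr
    have t5 : L * dist p pb ≤ L * τ := by gcongr
    rw [hc]
    linarith
  have hgρ : ∀ v p x, ‖v - vb‖ < τ → dist p pb < τ → ‖x - xb‖ ≤ δ → ‖g v p x - yb‖ < ρ :=
    fun v p x hv hp hx => (hgb v p x hv hp hx).trans_lt hδρ
  have hsolR : ∀ v p x, x ∈ SolMapVI f C v p ↔ x = R (g v p x) := fun v p x => by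
    rw [← hR, SolMapVI, Set.mem_ofPred_eq, add_sub_cancel_right]
  have hmaps : ∀ v p, ‖v - vb‖ < τ → dist p pb < τ →
      MapsTo (fun x => R (g v p x)) (closedBall xb δ) (closedBall xb δ) := fun v p hv hp x hx => by
    rw [mem_closedBall_iff_norm] at hx ⊢
    have h1 := hmono _ yb (hgρ v p x hv hp hx) (by simpa)
    have h2 := norm_sub_le_of_inner hc0 h1
    rw [hRb] at h2
    refine h2.trans ?_
    rw [div_le_iff₀ hc0, mul_comm]
    exact hgb v p x hv hp hx
  have hcontr : ∀ v p x x', ‖v - vb‖ < τ → dist p pb < τ → ‖x - xb‖ ≤ δ → ‖x' - xb‖ ≤ δ →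
      ‖R (g v p x) - R (g v p x')‖ ≤ (κ / 2 + μ) / c * ‖x - x'‖ := by
    intro v p x x' hv hp hx hx'
    have h2 := norm_sub_le_of_inner hc0 (hmono _ _ (hgρ v p x hv hp hx) (hgρ v p x' hv hp hx'))
    refine h2.trans ?_
    rw [div_mul_eq_mul_div]
    gcongr
    have s1 := hstrict x x' p (by linarith) (by linarith) (by linarith)
    have hdec : g v p x - g v p x' = μ • (x - x') - (f x p - f x' p - A (x - x')) := by
      simp only [g, hBapp, map_sub, smul_sub]
      abel
    rw [hdec]
    refine (norm_sub_le _ _).trans ?_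
    rw [norm_smul, Real.norm_of_nonneg hμ0.le]
    linarith
  have hq0 : 0 ≤ (κ / 2 + μ) / c := by positivity
  have hq1 : (κ / 2 + μ) / c < 1 := (div_lt_one hc0).2 (by rw [hc]; linarith)
  have hexist : ∀ v p, ∃ x, ‖v - vb‖ < τ → dist p pb < τ →
      ‖x - xb‖ ≤ δ ∧ x ∈ SolMapVI f C v p := fun v p => by
    by_cases hvp : ‖v - vb‖ < τ ∧ dist p pb < τ
    · obtain ⟨hv, hp⟩ := hvp
      have hK : ContractingWith ((κ / 2 + μ) / c).toNNReal ((hmaps v p hv hp).restrict _ _ _) := by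
        refine ⟨Real.toNNReal_lt_one.2 hq1, LipschitzWith.of_dist_le_mul fun a b => ?_⟩
        rw [Real.coe_toNNReal _ hq0, Subtype.dist_eq, Subtype.dist_eq, dist_eq_norm, dist_eq_norm]
        exact hcontr v p a b hv hp (mem_closedBall_iff_norm.1 a.2) (mem_closedBall_iff_norm.1 b.2)
      obtain ⟨x, hx, hfix, -⟩ := hK.exists_fixedPoint' isClosed_closedBall.isComplete
        (hmaps v p hv hp) (mem_closedBall_self hδ.le) (edist_ne_top _ _)
      exact ⟨x, fun _ _ => ⟨mem_closedBall_iff_norm.1 hx, (hsolR v p x).2 hfix.eq.symm⟩⟩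
    · exact ⟨xb, fun hv hp => absurd ⟨hv, hp⟩ hvp⟩
  choose ϑ hϑ using hexist
  refine ⟨ball vb τ, ball_mem_nhds _ hτ, ball pb τ, ball_mem_nhds _ hτ, closedBall xb δ,
    closedBall_mem_nhds _ hδ, ϑ, ?_, κ / 2, half_pos hκ, 2 * L, by positivity, ?_⟩
  · intro v hv p hp
    rw [mem_ball_iff_norm] at hv
    obtain ⟨h1, h2⟩ := hϑ v p hv hp
    refine ⟨mem_closedBall_iff_norm.2 h1, h2, fun x hx hxs => ?_⟩
    have h3 := hcontr v p x (ϑ v p) hv hp (mem_closedBall_iff_norm.1 hx) h1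
    rw [← (hsolR v p x).1 hxs, ← (hsolR v p _).1 h2] at h3
    have h4 : ‖x - ϑ v p‖ ≤ 0 := by nlinarith [norm_nonneg (x - ϑ v p)]
    exact sub_eq_zero.1 (norm_le_zero_iff.1 h4)
  · intro v₁ hv₁ p₁ hp₁ v₂ hv₂ p₂ hp₂
    rw [mem_ball_iff_norm] at hv₁ hv₂
    rw [mem_ball] at hp₁ hp₂
    obtain ⟨hx₁, hs₁⟩ := hϑ v₁ p₁ hv₁ hp₁
    obtain ⟨hx₂, hs₂⟩ := hϑ v₂ p₂ hv₂ hp₂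
    have h1 := hmono _ _ (hgρ v₁ p₁ _ hv₁ hp₁ hx₁) (hgρ v₂ p₂ _ hv₂ hp₂ hx₂)
    rw [← (hsolR v₁ p₁ _).1 hs₁, ← (hsolR v₂ p₂ _).1 hs₂] at h1
    set x₁ := ϑ v₁ p₁
    set x₂ := ϑ v₂ p₂
    have s1 := hstrict x₁ x₂ p₁ (by linarith) (by linarith) (by linarith)
    have s2 := hlip x₂ x₂ p₁ p₂ (by linarith) (by linarith) (by linarith) (by linarith)
    rw [sub_self, norm_zero, zero_add] at s2
    set e := f x₂ p₁ - f x₂ p₂ with he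
    have hdec : g v₁ p₁ x₁ - g v₂ p₂ x₂
        = (v₁ - v₂ - e) - (f x₁ p₁ - f x₂ p₁ - A (x₁ - x₂)) + μ • (x₁ - x₂) := by
      simp only [g, he, hBapp, map_sub, smul_sub]
      abel
    rw [hdec, inner_add_left, inner_sub_left, real_inner_smul_left,
      real_inner_self_eq_norm_sq] at h1
    have h2 := neg_le_of_abs_le
      (abs_real_inner_le_norm (f x₁ p₁ - f x₂ p₁ - A (x₁ - x₂)) (x₁ - x₂))
    have h3 := mul_le_mul_of_nonneg_right s1 (norm_nonneg (x₁ - x₂))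
    have h4 : κ / 2 * ‖x₁ - x₂‖ ^ 2 ≤ ⟪v₁ - v₂ - e, x₁ - x₂⟫ := by
      rw [hc] at h1
      nlinarith
    have h5 : ‖(v₁ - v₂ - e) - (2 * (κ / 2)) • (x₁ - x₂)‖ ≤ ‖v₁ - v₂ - e‖ := by
      refine (sq_le_sq₀ (norm_nonneg _) (norm_nonneg _)).1 ?_
      rw [norm_sub_sq_real, norm_smul, real_inner_smul_right, Real.norm_of_nonneg (by positivity)]
      nlinarith
    have h6 : (v₁ - v₂) - (2 * (κ / 2)) • (x₁ - x₂)
        = ((v₁ - v₂ - e) - (2 * (κ / 2)) • (x₁ - x₂)) + e := by abel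
    rw [h6]
    have h7 := norm_add_le ((v₁ - v₂ - e) - (2 * (κ / 2)) • (x₁ - x₂)) e
    have h8 := norm_sub_le (v₁ - v₂) e
    linarith

/-- On a polyhedric set, full stability forces uniform coercivity on nearby critical cones. -/
lemma FullStable2.exists_coercive {f : X → P → X} {Df : X → P → X →L[ℝ] X}
    {C : Set X} (hcv : Convex ℝ C) {xb vb : X} {pb : P} (hA1 : A1two f xb pb)
    (hA4 : A4two f Df xb pb)
    (hpoly : Polyhedric C) (hst : FullStable2 (SolMapVI f C) xb vb pb) :
    ∃ κ > 0, ∃ η > 0, ∀ x v, v ∈ convNC C x → ‖x - xb‖ < η → ‖v - (vb - f xb pb)‖ < η →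
      ∀ w ∈ criticalCone C x v, κ * ‖w‖ ^ 2 ≤ ⟪Df xb pb w, w⟫ := by
  obtain ⟨V, hV, Pn, hPn, U, hU, ϑ, hloc, κ, hκ, ℓ, -, hest⟩ := hst
  obtain ⟨δ₁, hδ₁, hstrict⟩ := hA4.strict (half_pos hκ)
  obtain ⟨L, hL, δ₂, hδ₂, hlip⟩ := hA1
  obtain ⟨ρV, hρV, hballV⟩ := Metric.mem_nhds_iff.1 hV
  obtain ⟨ρU, hρU, hballU⟩ := Metric.mem_nhds_iff.1 hU
  have hpb : pb ∈ Pn := mem_of_mem_nhds hPn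
  obtain ⟨η, hη, hη1, hη2, hηU, hηV⟩ :
      ∃ η > 0, η ≤ δ₁ ∧ η ≤ δ₂ ∧ η ≤ ρU ∧ (1 + L) * η ≤ ρV := by
    refine ⟨min δ₁ (min δ₂ (min ρU (ρV / (1 + L)))), by positivity, ?_, ?_, ?_, ?_⟩
    · exact min_le_left _ _
    · exact (min_le_right _ _).trans (min_le_left _ _)
    · exact ((min_le_right _ _).trans (min_le_right _ _)).trans (min_le_left _ _)
    · have h1 : min δ₁ (min δ₂ (min ρU (ρV / (1 + L)))) ≤ ρV / (1 + L) :=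
        ((min_le_right _ _).trans (min_le_right _ _)).trans (min_le_right _ _)
      calc _ ≤ (1 + L) * (ρV / (1 + L)) := by gcongr
        _ = ρV := by field_simp
  have hgraph : ∀ x v, v ∈ convNC C x → ‖x - xb‖ < η → ‖v - (vb - f xb pb)‖ < η →
      v + f x pb ∈ V ∧ x = ϑ (v + f x pb) pb := by
    intro x v hv hx hvη
    have hmemV : v + f x pb ∈ V := by
      refine hballV (mem_ball_iff_norm.2 ?_)
      have s := hlip x xb pb pb (by linarith) (by simpa) (by simpa) (by simpa)
      rw [dist_self, add_zero] at s
      have hdec : v + f x pb - vb = (v - (vb - f xb pb)) + (f x pb - f xb pb) := by abel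
      rw [hdec]
      have s1 := norm_add_le (v - (vb - f xb pb)) (f x pb - f xb pb)
      have s2 : L * ‖x - xb‖ ≤ L * η := by gcongr
      linarith
    refine ⟨hmemV, (hloc _ hmemV pb hpb).2.2 x (hballU (mem_ball_iff_norm.2 (by linarith))) ?_⟩
    rwa [SolMapVI, Set.mem_ofPred_eq, add_sub_cancel_right]
  refine ⟨κ / 2, half_pos hκ, η, hη, fun x v hv hx hvη w hw => ?_⟩
  rw [hpoly x hv.1 v hv] at hw
  have hclosed : IsClosed {w | κ / 2 * ‖w‖ ^ 2 ≤ ⟪Df xb pb w, w⟫} :=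
    isClosed_le (by fun_prop) (by fun_prop)
  refine closure_minimal ?_ hclosed hw
  rintro u ⟨⟨t₀, ht₀, hu⟩, huv : ⟪v, u⟫ = 0⟩
  have hsmall : ∀ᶠ t in 𝓝[>] (0 : ℝ), ‖x + t • u - xb‖ < η := by
    have hc : Continuous fun t : ℝ => ‖x + t • u - xb‖ := by fun_prop
    exact (hc.continuousAt.eventually_lt_const (by simpa using hx)).filter_mono nhdsWithin_le_nhds
  obtain ⟨t, ⟨htη, htt₀⟩, ht : 0 < t⟩ :=
    ((hsmall.and (nhdsWithin_le_nhds (Iio_mem_nhds ht₀))).and self_mem_nhdsWithin).exists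
  have htC : x + t • u ∈ C := add_smul_mem_of_le hcv hv.1 ht.le (le_of_lt htt₀) hu
  have hv' := convNC_add_smul hv huv htC
  obtain ⟨hV₁, he₁⟩ := hgraph _ _ hv' htη hvη
  obtain ⟨hV₂, he₂⟩ := hgraph _ _ hv hx hvη
  have h := hest _ hV₁ pb hpb _ hV₂ pb hpb
  rw [← he₁, ← he₂, add_sub_add_left_eq_sub, add_sub_cancel_left, dist_self, mul_zero,
    add_zero] at h
  have s := hstrict (x + t • u) x pb (by linarith) (by linarith) (by simpa)
  rw [add_sub_cancel_left] at s
  set F := f (x + t • u) pb - f x pb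
  have h1 : κ * ‖t • u‖ ^ 2 ≤ ⟪F, t • u⟫ := by
    have h2 := pow_le_pow_left₀ (norm_nonneg _) h 2
    rw [norm_sub_sq_real, norm_smul, real_inner_smul_right,
      Real.norm_of_nonneg (show 0 ≤ 2 * κ by positivity)] at h2
    have h3 : κ * (κ * ‖t • u‖ ^ 2) ≤ κ * ⟪F, t • u⟫ := by nlinarith
    exact le_of_mul_le_mul_left h3 hκ
  have h2 := (real_inner_le_norm (F - Df xb pb (t • u)) (t • u)).trans
    (mul_le_mul_of_nonneg_right s (norm_nonneg _))
  rw [inner_sub_left] at h2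
  have h3 : κ / 2 * ‖t • u‖ ^ 2 ≤ ⟪Df xb pb (t • u), t • u⟫ := by nlinarith
  rw [norm_smul, Real.norm_of_nonneg ht.le, map_smul, real_inner_smul_left,
    real_inner_smul_right] at h3
  have h4 : t ^ 2 * (κ / 2 * ‖u‖ ^ 2) ≤ t ^ 2 * ⟪Df xb pb u, u⟫ := by nlinarith
  exact le_of_mul_le_mul_left h4 (by positivity)

/-- Uniform coercivity on nearby critical cones passes to their strong outer limit. -/
lemma inner_map_pos_of_mem_Hs {C : Set X} {A : X →L[ℝ] X} {xb vh w : X} {κ η : ℝ} (hκ : 0 < κ)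
    (hη : 0 < η) (hco : ∀ x v, v ∈ convNC C x → ‖x - xb‖ < η → ‖v - vh‖ < η →
      ∀ w ∈ criticalCone C x v, κ * ‖w‖ ^ 2 ≤ ⟪A w, w⟫)
    (hw : w ∈ Hs C xb vh) (hw0 : w ≠ 0) : 0 < ⟪A w, w⟫ := by
  obtain ⟨xs, vs, ws, hN, hx, hv, hws, hlim⟩ := hw
  have hpos : 0 < κ * ‖w‖ ^ 2 := by positivity
  have h1 : Tendsto (fun k => κ * ‖ws k‖ ^ 2) atTop (𝓝 (κ * ‖w‖ ^ 2)) :=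
    (hlim.norm.pow 2).const_mul κ
  have h2 : Tendsto (fun k => ⟪A (ws k), ws k⟫) atTop (𝓝 ⟪A w, w⟫) :=
    ((A.continuous.tendsto w).comp hlim).inner hlim
  refine hpos.trans_le (le_of_tendsto_of_tendsto h1 h2 ?_)
  filter_upwards [(tendsto_iff_norm_sub_tendsto_zero.1 hx).eventually_lt_const hη,
    (tendsto_iff_norm_sub_tendsto_zero.1 hv).eventually_lt_const hη] with k hxk hvk
  exact hco _ _ (hN k) hxk hvk _ (hws k)

end VariationalInequality

/-- pointbased sufficient and necessary conditions for full
stability of solutions to parametric variational inequalities (Theorem 8.4). -/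
theorem statement13
    {X : Type*} [NormedAddCommGroup X] [InnerProductSpace ℝ X] [CompleteSpace X]
    {P : Type*} [MetricSpace P]
    (f : X → P → X) (Df : X → P → X →L[ℝ] X)
    (C : Set X) (hCne : C.Nonempty) (hCcl : IsClosed C) (hCcv : Convex ℝ C)
    (xb vb vh : X) (pb : P)
    (hvh : vh = vb - f xb pb)
    (hsol : xb ∈ SolMapVI f C vb pb)
    (hA1 : A1two f xb pb) (hA4 : A4two f Df xb pb) :
    ((LegendreForm (fun w => ⟪Df xb pb w, w⟫) ∧
        (∀ w ∈ Hw C xb vh, w ≠ 0 → 0 < ⟪Df xb pb w, w⟫)) →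
      FullStable2 (SolMapVI f C) xb vb pb) ∧
    (Polyhedric C → FullStable2 (SolMapVI f C) xb vb pb →
      ∀ w ∈ Hs C xb vh, w ≠ 0 → 0 < ⟪Df xb pb w, w⟫) := by
  subst hvh
  refine ⟨fun ⟨hleg, hpos⟩ => ?_, fun hpoly hst w hw hw0 => ?_⟩
  · obtain ⟨κ, hκ, η, hη, hco⟩ := exists_coercive_of_legendreForm hleg hpos
    exact fullStable2_of_coercive hCne hCcl hCcv hsol hA1 hA4 hκ hη hco
  · obtain ⟨κ, hκ, η, hη, hco⟩ := hst.exists_coercive hCcv hA1 hA4 hpoly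
    exact inner_map_pos_of_mem_Hs hκ hη hco hw hw0

end PVS
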